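/- For every tempered distribution u on ℝ^{2d} (continuous linear functional on 𝒮(ℝ^{2d};ℂ)) and every Schwartz function H ∈ 𝒮(ℝ^{2d};ℂ), the series Σ_{α̃,β̃∈ℤ^d×ℤ^d} u(T_{α̃,β̃}) · (∫_{ℝ^{2d}} G_{α̃,β̃}(x,y) H(x,y) dx dy) converges absolutely and its sum equals u(H), where T_{α̃,β̃}(x,y) := conj(𝒢_α̃(x)) · 𝒢_β̃(y); that is, the frame expansion of u converges to u in the weak-* sense. -/

import Mathlib

open MeasureTheory Filter
open scoped ENNReal

noncomputable section

/-- Japanese bracket `⟨v⟩ = √(1+‖v‖²)` with the Euclidean norm on `ℝ^N`. -/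
def jbV {N : ℕ} (v : Fin N → ℝ) : ℝ := Real.sqrt (1 + ∑ i, v i ^ 2)

/-- A tempered weight on `ℝ^N`: a positive function `m` with
`m(u+v) ≤ C·m(u)·⟨v⟩^a` for some `C, a > 0`. -/
def IsTemperedWeight {N : ℕ} (m : (Fin N → ℝ) → ℝ) : Prop :=
  (∀ u, 0 < m u) ∧ ∃ C > 0, ∃ a : ℝ, 0 < a ∧ ∀ u v, m (u + v) ≤ C * m u * jbV v ^ a

/-- A regular magnetic field on `ℝ^d`: smooth, antisymmetric, closed, with all
derivatives of all components bounded. -/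
structure IsRegularMagneticField (d : ℕ) (B : Fin d → Fin d → (Fin d → ℝ) → ℝ) : Prop where
  smooth : ∀ j k, ContDiff ℝ (⊤ : ℕ∞) (B j k)
  antisymm : ∀ j k x, B j k x = - B k j x
  closed : ∀ i j k, ∀ x : Fin d → ℝ,
      fderiv ℝ (B j k) x (Pi.single i 1) + fderiv ℝ (B k i) x (Pi.single j 1)
        + fderiv ℝ (B i j) x (Pi.single k 1) = 0
  derivBounded : ∀ j k, ∀ n : ℕ, ∃ C : ℝ, ∀ x, ‖iteratedFDeriv ℝ n (B j k) x‖ ≤ C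

/-- The transversal-gauge vector potential based at `y`:
`A_k(x;y) = Σ_j ∫₀¹ s·(x_j−y_j)·B_{jk}(y+s(x−y)) ds`. -/
def magA (d : ℕ) (B : Fin d → Fin d → (Fin d → ℝ) → ℝ) (y x : Fin d → ℝ) (k : Fin d) : ℝ :=
  ∑ j, ∫ s in (0:ℝ)..1, s * (x j - y j) * B j k (y + s • (x - y))

/-- The circulation `φ(x,y) = Σ_k ∫₀¹ A_k(y+s(x−y))·(x_k−y_k) ds` of `A = A(·;0)`
along the segment from `y` to `x`. -/
def magPhi (d : ℕ) (B : Fin d → Fin d → (Fin d → ℝ) → ℝ) (x y : Fin d → ℝ) : ℝ :=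
  ∑ k, ∫ s in (0:ℝ)..1, magA d B 0 (y + s • (x - y)) k * (x k - y k)

/-- A window function for the magnetic Gabor frame: smooth, compactly supported in
`(−1,1)^d`, with `Σ_{α∈ℤ^d} 𝔤(x−α)² = 1`. -/
structure IsWindow (d : ℕ) (g : (Fin d → ℝ) → ℝ) : Prop where
  smooth : ContDiff ℝ (⊤ : ℕ∞) g
  compactSupport : HasCompactSupport g
  support_subset : ∀ x : Fin d → ℝ, g x ≠ 0 → ∀ i, |x i| < 1
  partition : ∀ x : Fin d → ℝ, ∑' α : Fin d → ℤ, (g (x - fun i => (α i : ℝ))) ^ 2 = 1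

abbrev Idx (d : ℕ) := (Fin d → ℤ) × (Fin d → ℤ)
abbrev Idx2 (d : ℕ) := Idx d × Idx d
abbrev E1 (d : ℕ) := Fin d → ℝ
abbrev E2 (d : ℕ) := E1 d × E1 d
abbrev E4 (d : ℕ) := E2 d × E2 d

/-- The magnetic Gabor function
`𝒢_α̃(x) = (2π)^{−d/2}·e^{iφ(x,α)}·𝔤(x−α)·e^{iα'·(x−α)}` for `α̃ = (α,α')`. -/
def gabor (d : ℕ) (B : Fin d → Fin d → E1 d → ℝ) (g : E1 d → ℝ) (a : Idx d) (x : E1 d) : ℂ :=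
  (((2 * Real.pi) ^ (-(d : ℝ) / 2) : ℝ) : ℂ) *
    Complex.exp (Complex.I * (magPhi d B x (fun i => (a.1 i : ℝ)) : ℂ)) *
    ((g (x - fun i => (a.1 i : ℝ)) : ℝ) : ℂ) *
    Complex.exp (Complex.I * ((∑ i, (a.2 i : ℝ) * (x i - (a.1 i : ℝ)) : ℝ) : ℂ))

/-- `G_{α̃,β̃}(x,y) = 𝒢_α̃(x)·conj(𝒢_β̃(y))`. -/
def gaborTensor (d : ℕ) (B : Fin d → Fin d → E1 d → ℝ) (g : E1 d → ℝ) (a b : Idx d)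
    (p : E2 d) : ℂ :=
  gabor d B g a p.1 * (starRingEnd ℂ) (gabor d B g b p.2)

/-- `T_{α̃,β̃}(x,y) = conj(𝒢_α̃(x))·𝒢_β̃(y)`. -/
def gaborDual (d : ℕ) (B : Fin d → Fin d → E1 d → ℝ) (g : E1 d → ℝ) (a b : Idx d)
    (p : E2 d) : ℂ :=
  (starRingEnd ℂ) (gabor d B g a p.1) * gabor d B g b p.2

/-- The frame coefficient `c_{α̃,β̃}(F) = ∫ F(x,y)·conj(𝒢_α̃(x))·𝒢_β̃(y) dx dy`. -/
def frameCoef (d : ℕ) (B : Fin d → Fin d → E1 d → ℝ) (g : E1 d → ℝ) (a b : Idx d)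
    (F : E2 d → ℂ) : ℂ :=
  ∫ p : E2 d, F p * (starRingEnd ℂ) (gabor d B g a p.1) * gabor d B g b p.2

/-- `⟨(α̃,β̃)⟩` with `(α̃,β̃)` regarded as a point of `ℝ^{4d}`. -/
def jbIdxPair (d : ℕ) (a b : Idx d) : ℝ :=
  Real.sqrt (1 + (∑ i, ((a.1 i : ℝ)) ^ 2) + (∑ i, ((a.2 i : ℝ)) ^ 2)
    + (∑ i, ((b.1 i : ℝ)) ^ 2) + ∑ i, ((b.2 i : ℝ)) ^ 2)

/-- Euclidean Japanese bracket on `ℝ^{4d} = E4 d`. -/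
def jbE4 (d : ℕ) (v : E4 d) : ℝ :=
  Real.sqrt (1 + (∑ i, v.1.1 i ^ 2) + (∑ i, v.1.2 i ^ 2) + (∑ i, v.2.1 i ^ 2) + ∑ i, v.2.2 i ^ 2)

/-- A tempered weight on `ℝ^{4d}`. -/
def IsTemperedWeightE4 (d : ℕ) (M : E4 d → ℝ) : Prop :=
  (∀ u, 0 < M u) ∧ ∃ C > 0, ∃ a : ℝ, 0 < a ∧ ∀ u v, M (u + v) ≤ C * M u * jbE4 d v ^ a

/-- Euclidean Japanese bracket on `ℝ^N × ℝ^N`. -/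
def jbP {N : ℕ} (v : (Fin N → ℝ) × (Fin N → ℝ)) : ℝ :=
  Real.sqrt (1 + (∑ i, v.1 i ^ 2) + ∑ i, v.2 i ^ 2)

/-- A tempered weight on `ℝ^N × ℝ^N ≅ ℝ^{2N}`. -/
def IsTemperedWeightProd {N : ℕ} (m : (Fin N → ℝ) × (Fin N → ℝ) → ℝ) : Prop :=
  (∀ u, 0 < m u) ∧ ∃ C > 0, ∃ a : ℝ, 0 < a ∧ ∀ u v, m (u + v) ≤ C * m u * jbP v ^ a

/-- `⟨(α̃,β̃) − (γ̃,δ̃)⟩` for pairs of indices in `ℤ^{2d} × ℤ^{2d}`. -/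
def jbDiffIdx2 (d : ℕ) (p q : Idx2 d) : ℝ :=
  Real.sqrt (1 + (∑ i, ((p.1.1 i - q.1.1 i : ℤ) : ℝ) ^ 2) + (∑ i, ((p.1.2 i - q.1.2 i : ℤ) : ℝ) ^ 2)
    + (∑ i, ((p.2.1 i - q.2.1 i : ℤ) : ℝ) ^ 2) + ∑ i, ((p.2.2 i - q.2.2 i : ℤ) : ℝ) ^ 2)

/-- The midpoint `((α̃,β̃)+(γ̃,δ̃))/2 ∈ ℝ^{4d}`. -/
def midIdx2 (d : ℕ) (p q : Idx2 d) : E4 d :=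
  ((fun i => ((p.1.1 i + q.1.1 i : ℤ) : ℝ) / 2, fun i => ((p.1.2 i + q.1.2 i : ℤ) : ℝ) / 2),
   (fun i => ((p.2.1 i + q.2.1 i : ℤ) : ℝ) / 2, fun i => ((p.2.2 i + q.2.2 i : ℤ) : ℝ) / 2))

/-- Membership in the Hörmander class `S₀(M)` on `ℝ^{4d}`: smooth, with all
derivatives dominated by `M`. -/
def InS0 (d : ℕ) (M : E4 d → ℝ) (Φ : E4 d → ℂ) : Prop :=
  ContDiff ℝ (⊤ : ℕ∞) Φ ∧ ∀ n : ℕ, ∃ C : ℝ, ∀ X, ‖iteratedFDeriv ℝ n Φ X‖ ≤ C * M X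

/-- The seminorms `‖Φ‖_{S₀(M),k}`. -/
def s0Seminorm (d : ℕ) (M : E4 d → ℝ) (k : ℕ) (Φ : E4 d → ℂ) : ℝ :=
  ∑ n ∈ Finset.range (k + 1), ⨆ X : E4 d, ‖iteratedFDeriv ℝ n Φ X‖ / M X

/-- The integrand of the inner (oscillatory) integral defining `H_{(α̃,β̃),(γ̃,δ̃)}`,
evaluated at `X = ((v_L,ξ_L),(v_R,ξ_R))` and `z = (z_L,z_R)`. -/
def gaborKernel4 (d : ℕ) (B : Fin d → Fin d → E1 d → ℝ) (g : E1 d → ℝ) (ab gd : Idx2 d)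
    (X : E4 d) (z : E2 d) : ℂ :=
  Complex.exp (Complex.I * (((∑ i, X.1.2 i * z.1 i) - ∑ i, X.2.2 i * z.2 i : ℝ) : ℂ)) *
  Complex.exp (Complex.I * ((magPhi d B (X.1.1 + (2 : ℝ)⁻¹ • z.1) (X.1.1 - (2 : ℝ)⁻¹ • z.1)
      - magPhi d B (X.2.1 + (2 : ℝ)⁻¹ • z.2) (X.2.1 - (2 : ℝ)⁻¹ • z.2) : ℝ) : ℂ)) *
  gabor d B g gd.1 (X.1.1 + (2 : ℝ)⁻¹ • z.1) *
  (starRingEnd ℂ) (gabor d B g gd.2 (X.2.1 + (2 : ℝ)⁻¹ • z.2)) *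
  (starRingEnd ℂ) (gabor d B g ab.1 (X.1.1 - (2 : ℝ)⁻¹ • z.1)) *
  gabor d B g ab.2 (X.2.1 - (2 : ℝ)⁻¹ • z.2)

/-- The kernel `H_{(α̃,β̃),(γ̃,δ̃)}` on `ℝ^{4d}`. -/
def matH (d : ℕ) (B : Fin d → Fin d → E1 d → ℝ) (g : E1 d → ℝ) (ab gd : Idx2 d)
    (X : E4 d) : ℂ :=
  (((2 * Real.pi) ^ (-(2 * (d : ℝ))) : ℝ) : ℂ) * ∫ z : E2 d, gaborKernel4 d B g ab gd X z

/-- The matrix element `𝕄_{(α̃,β̃),(γ̃,δ̃)}[Φ] = ∫ Φ·H_{(α̃,β̃),(γ̃,δ̃)}`. -/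
def matElem (d : ℕ) (B : Fin d → Fin d → E1 d → ℝ) (g : E1 d → ℝ) (Φ : E4 d → ℂ)
    (ab gd : Idx2 d) : ℂ :=
  ∫ X : E4 d, Φ X * matH d B g ab gd X

/-- The dequantized frame symbol
`g_{α̃,γ̃}(v,ξ) = ∫ e^{−iξ·z}·e^{−iφ(v+z/2,v−z/2)}·𝒢_α̃(v+z/2)·conj(𝒢_γ̃(v−z/2)) dz`. -/
def deqSymbol (d : ℕ) (B : Fin d → Fin d → E1 d → ℝ) (g : E1 d → ℝ) (ac : Idx d × Idx d)
    (vξ : E2 d) : ℂ :=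
  ∫ z : E1 d,
    Complex.exp (-Complex.I * ((∑ i, vξ.2 i * z i : ℝ) : ℂ)) *
    Complex.exp (-Complex.I * ((magPhi d B (vξ.1 + (2 : ℝ)⁻¹ • z) (vξ.1 - (2 : ℝ)⁻¹ • z) : ℝ) : ℂ)) *
    gabor d B g ac.1 (vξ.1 + (2 : ℝ)⁻¹ • z) *
    (starRingEnd ℂ) (gabor d B g ac.2 (vξ.1 - (2 : ℝ)⁻¹ • z))

section TemperateGrowth

variable {E F : Type*} [NormedAddCommGroup E] [NormedSpace ℝ E]
  [NormedAddCommGroup F] [NormedSpace ℝ F]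

theorem hasTemperateGrowth_fderiv {f : E → F} (hf : f.HasTemperateGrowth) :
    (fderiv ℝ f).HasTemperateGrowth := by
  refine ⟨hf.1.fderiv_right (by simp), fun n => ?_⟩
  obtain ⟨k, C, h⟩ := hf.2 (n + 1)
  exact ⟨k, C, fun x => by simpa only [norm_iteratedFDeriv_fderiv] using h x⟩

theorem hasTemperateGrowth_prodMk {G : Type*} [NormedAddCommGroup G] [NormedSpace ℝ G]
    {f : E → F} {g : E → G} (hf : f.HasTemperateGrowth) (hg : g.HasTemperateGrowth) :
    (fun x => (f x, g x)).HasTemperateGrowth := by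
  have h : (fun x => (f x, g x)) = fun x => ContinuousLinearMap.inl ℝ F G (f x)
      + ContinuousLinearMap.inr ℝ F G (g x) := by
    funext x; simp
  rw [h]
  exact .add ((ContinuousLinearMap.inl ℝ F G).hasTemperateGrowth.comp hf)
    ((ContinuousLinearMap.inr ℝ F G).hasTemperateGrowth.comp hg)

theorem hasTemperateGrowth_of_bounded_derivs {f : E → F} (hf : ContDiff ℝ (⊤ : ℕ∞) f)
    (h : ∀ n : ℕ, ∃ C : ℝ, ∀ x, ‖iteratedFDeriv ℝ n f x‖ ≤ C) : f.HasTemperateGrowth :=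
  ⟨hf, fun n => (h n).elim fun C hC => ⟨0, C, by simpa using hC⟩⟩

theorem hasTemperateGrowth_exp_I_mul :
    (fun t : ℝ => Complex.exp (Complex.I * (t : ℂ))).HasTemperateGrowth := by
  have hc : ContDiff ℝ (⊤ : ℕ∞) (fun t : ℝ => Complex.exp (Complex.I * (t : ℂ))) :=
    (contDiff_const.mul Complex.ofRealCLM.contDiff).cexp
  refine hasTemperateGrowth_of_bounded_derivs hc fun n => ⟨1, fun x => ?_⟩
  have hd : ∀ n : ℕ, iteratedDeriv n (fun t : ℝ => Complex.exp (Complex.I * (t : ℂ))) =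
      fun t : ℝ => Complex.I ^ n * Complex.exp (Complex.I * (t : ℂ)) := by
    intro n
    induction n with
    | zero => simp
    | succ n ih =>
      rw [iteratedDeriv_succ, ih]
      funext t
      have h1 : HasDerivAt (fun t : ℝ => Complex.I * (t : ℂ)) (Complex.I * 1) t :=
        (Complex.ofRealCLM.hasDerivAt (x := t)).const_mul _
      have h2 := (h1.cexp.const_mul (Complex.I ^ n)).deriv
      rw [h2]
      ring
  rw [norm_iteratedFDeriv_eq_norm_iteratedDeriv, hd]
  rw [norm_mul, norm_pow, Complex.norm_I, one_pow, one_mul, mul_comm,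
    Complex.norm_exp_ofReal_mul_I]

end TemperateGrowth

section ParametricIntegral

universe w

variable {E : Type w} [NormedAddCommGroup E] [NormedSpace ℝ E]

theorem norm_unitInterval_integral_le {F : Type*} [NormedAddCommGroup F] [NormedSpace ℝ F]
    {f : E × ℝ → F} (hf : f.HasTemperateGrowth) :
    ∃ (k : ℕ) (C : ℝ), 0 ≤ C ∧ (∀ x, ∀ s ∈ Set.uIoc (0:ℝ) 1, ‖f (x, s)‖ ≤ C * (1 + ‖x‖) ^ k) ∧
      ∀ x, ‖∫ s in (0:ℝ)..1, f (x, s)‖ ≤ C * (1 + ‖x‖) ^ k := by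
  obtain ⟨k, C, hC, h⟩ := hf.norm_iteratedFDeriv_le_uniform 0
  have key : ∀ x, ∀ s ∈ Set.uIoc (0:ℝ) 1, ‖f (x, s)‖ ≤ C * 2 ^ k * (1 + ‖x‖) ^ k := by
    intro x s hs
    rw [Set.uIoc_of_le zero_le_one] at hs
    have h0 := h 0 le_rfl (x, s)
    rw [norm_iteratedFDeriv_zero] at h0
    refine h0.trans ?_
    rw [mul_assoc, ← mul_pow]
    gcongr
    have : ‖(x, s)‖ ≤ ‖x‖ + 1 := by
      rw [Prod.norm_def]
      refine max_le (by simp) ?_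
      rw [Real.norm_eq_abs, abs_of_pos hs.1]
      linarith [hs.2, norm_nonneg x]
    linarith [norm_nonneg x]
  refine ⟨k, C * 2 ^ k, by positivity, key, fun x => ?_⟩
  simpa using intervalIntegral.norm_integral_le_of_norm_le_const (key x)

theorem hasFDerivAt_unitInterval_integral {F : Type*} [NormedAddCommGroup F] [NormedSpace ℝ F]
    {f : E × ℝ → F} (hf : f.HasTemperateGrowth) (x : E) :
    HasFDerivAt (fun x => ∫ s in (0:ℝ)..1, f (x, s))
      (∫ s in (0:ℝ)..1, (fderiv ℝ f (x, s)).comp (ContinuousLinearMap.inl ℝ E ℝ)) x := by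
  have hcont : Continuous f := hf.1.continuous
  have hf' : (fun z => (fderiv ℝ f z).comp (ContinuousLinearMap.inl ℝ E ℝ)).HasTemperateGrowth :=
    ((ContinuousLinearMap.compL ℝ E (E × ℝ) F).flip
      (ContinuousLinearMap.inl ℝ E ℝ)).hasTemperateGrowth.comp (hasTemperateGrowth_fderiv hf)
  obtain ⟨k, C, hC, hb, -⟩ := norm_unitInterval_integral_le hf'
  refine intervalIntegral.hasFDerivAt_integral_of_dominated_of_fderiv_le
    (F' := fun x s => (fderiv ℝ f (x, s)).comp (ContinuousLinearMap.inl ℝ E ℝ))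
    (bound := fun _ => C * (1 + (‖x‖ + 1)) ^ k) (Metric.ball_mem_nhds x one_pos) ?_ ?_ ?_ ?_ ?_ ?_
  · exact Eventually.of_forall fun y => (by fun_prop : Continuous fun s => f (y, s)).aestronglyMeasurable
  · exact (by fun_prop : Continuous fun s => f (x, s)).intervalIntegrable _ _
  · exact (hf'.1.continuous.comp (by fun_prop : Continuous fun s : ℝ => (x, s))).aestronglyMeasurable
  · refine Eventually.of_forall fun s hs y hy => (hb y s hs).trans ?_
    gcongr
    have := norm_sub_norm_le y x
    rw [mem_ball_iff_norm] at hy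
    linarith
  · exact intervalIntegrable_const
  · refine Eventually.of_forall fun s _ y _ => ?_
    have h1 : HasFDerivAt f (fderiv ℝ f (y, s)) (y, s) :=
      (hf.1.differentiable (by simp)).differentiableAt.hasFDerivAt
    exact h1.comp y (hasFDerivAt_prodMk_left y s)

theorem contDiff_unitInterval_integral (n : ℕ) :
    ∀ {F : Type w} [NormedAddCommGroup F] [NormedSpace ℝ F] {f : E × ℝ → F},
      f.HasTemperateGrowth → ContDiff ℝ n (fun x => ∫ s in (0:ℝ)..1, f (x, s)) ∧
      ∃ (k : ℕ) (C : ℝ), ∀ x,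
        ‖iteratedFDeriv ℝ n (fun x => ∫ s in (0:ℝ)..1, f (x, s)) x‖ ≤ C * (1 + ‖x‖) ^ k := by
  induction n with
  | zero =>
    intro F _ _ f hf
    obtain ⟨k, C, -, -, h⟩ := norm_unitInterval_integral_le hf
    refine ⟨?_, k, C, fun x => by simpa using h x⟩
    exact contDiff_zero.2 (continuous_iff_continuousAt.2 fun x =>
      (hasFDerivAt_unitInterval_integral hf x).continuousAt)
  | succ n ih =>
    intro F _ _ f hf
    have hf' : (fun z => (fderiv ℝ f z).comp
        (ContinuousLinearMap.inl ℝ E ℝ)).HasTemperateGrowth :=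
      ((ContinuousLinearMap.compL ℝ E (E × ℝ) F).flip
        (ContinuousLinearMap.inl ℝ E ℝ)).hasTemperateGrowth.comp (hasTemperateGrowth_fderiv hf)
    have hfd : fderiv ℝ (fun x => ∫ s in (0:ℝ)..1, f (x, s)) = fun x => ∫ s in (0:ℝ)..1,
        (fderiv ℝ f (x, s)).comp (ContinuousLinearMap.inl ℝ E ℝ) :=
      funext fun x => (hasFDerivAt_unitInterval_integral hf x).fderiv
    obtain ⟨h1, k, C, h2⟩ := ih hf'
    refine ⟨?_, k, C, fun x => ?_⟩
    · push_cast
      refine contDiff_succ_iff_fderiv.2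
        ⟨fun x => (hasFDerivAt_unitInterval_integral hf x).differentiableAt, by simp, ?_⟩
      rw [hfd]
      exact h1
    · rw [← norm_iteratedFDeriv_fderiv, hfd]
      exact h2 x

/-- Integrating out a parameter in the unit interval preserves temperate growth. -/
theorem hasTemperateGrowth_unitInterval_integral {F : Type w} [NormedAddCommGroup F]
    [NormedSpace ℝ F] {f : E × ℝ → F} (hf : f.HasTemperateGrowth) :
    (fun x => ∫ s in (0:ℝ)..1, f (x, s)).HasTemperateGrowth :=
  ⟨contDiff_infty.2 fun n => (contDiff_unitInterval_integral n hf).1,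
    fun n => (contDiff_unitInterval_integral n hf).2⟩

end ParametricIntegral

section GaborTemperateGrowth

theorem hasTemperateGrowth_coord {E : Type*} [NormedAddCommGroup E] [NormedSpace ℝ E] {d : ℕ}
    {f : E → E1 d} (hf : f.HasTemperateGrowth) (i : Fin d) :
    (fun x => f x i).HasTemperateGrowth :=
  (ContinuousLinearMap.proj (R := ℝ) (φ := fun _ : Fin d => ℝ) i).hasTemperateGrowth.comp hf

theorem IsRegularMagneticField.hasTemperateGrowth {d : ℕ} {B : Fin d → Fin d → E1 d → ℝ}
    (hB : IsRegularMagneticField d B) (j k : Fin d) : (B j k).HasTemperateGrowth :=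
  hasTemperateGrowth_of_bounded_derivs (hB.smooth j k) (hB.derivBounded j k)

theorem hasTemperateGrowth_magA {d : ℕ} {B : Fin d → Fin d → E1 d → ℝ}
    (hB : IsRegularMagneticField d B) (k : Fin d) :
    (fun x => magA d B 0 x k).HasTemperateGrowth := by
  unfold magA
  refine .sum fun j _ => ?_
  have h1 : (Prod.fst : E1 d × ℝ → E1 d).HasTemperateGrowth :=
    (ContinuousLinearMap.fst ℝ (E1 d) ℝ).hasTemperateGrowth
  have h2 : (Prod.snd : E1 d × ℝ → ℝ).HasTemperateGrowth :=
    (ContinuousLinearMap.snd ℝ (E1 d) ℝ).hasTemperateGrowth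
  refine hasTemperateGrowth_unitInterval_integral
    (f := fun p : E1 d × ℝ => p.2 * (p.1 j - (0 : E1 d) j) * B j k (0 + p.2 • (p.1 - 0))) ?_
  simp only [Pi.zero_apply, sub_zero, zero_add]
  exact (h2.mul (hasTemperateGrowth_coord h1 j)).mul
    ((hB.hasTemperateGrowth j k).comp (h2.smul h1))

theorem hasTemperateGrowth_magPhi {d : ℕ} {B : Fin d → Fin d → E1 d → ℝ}
    (hB : IsRegularMagneticField d B) :
    (fun p : E1 d × E1 d => magPhi d B p.1 p.2).HasTemperateGrowth := by
  unfold magPhi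
  refine .sum fun k _ => ?_
  have h1 : (fun p : (E1 d × E1 d) × ℝ => p.1).HasTemperateGrowth :=
    (ContinuousLinearMap.fst ℝ (E1 d × E1 d) ℝ).hasTemperateGrowth
  have hx : (fun p : (E1 d × E1 d) × ℝ => p.1.1).HasTemperateGrowth :=
    (ContinuousLinearMap.fst ℝ (E1 d) (E1 d)).hasTemperateGrowth.comp h1
  have hy : (fun p : (E1 d × E1 d) × ℝ => p.1.2).HasTemperateGrowth :=
    (ContinuousLinearMap.snd ℝ (E1 d) (E1 d)).hasTemperateGrowth.comp h1
  have hs : (Prod.snd : (E1 d × E1 d) × ℝ → ℝ).HasTemperateGrowth :=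
    (ContinuousLinearMap.snd ℝ (E1 d × E1 d) ℝ).hasTemperateGrowth
  refine hasTemperateGrowth_unitInterval_integral
    (f := fun p : (E1 d × E1 d) × ℝ =>
      magA d B 0 (p.1.2 + p.2 • (p.1.1 - p.1.2)) k * (p.1.1 k - p.1.2 k)) ?_
  exact ((hasTemperateGrowth_magA hB k).comp (hy.add (hs.smul (hx.sub hy)))).mul
    ((hasTemperateGrowth_coord hx k).sub (hasTemperateGrowth_coord hy k))

/-- The unmodulated part `(2π)^{−d/2}·e^{iφ(x,γ)}·𝔤(x−γ)` of the magnetic Gabor functions,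
with a real translation parameter `γ`. -/
def magWindow (d : ℕ) (B : Fin d → Fin d → E1 d → ℝ) (g : E1 d → ℝ) (x γ : E1 d) : ℂ :=
  (((2 * Real.pi) ^ (-(d : ℝ) / 2) : ℝ) : ℂ) *
    Complex.exp (Complex.I * (magPhi d B x γ : ℂ)) * ((g (x - γ) : ℝ) : ℂ)

/-- The Euclidean pairing `∑ i, μ i * v i`. -/
def dotL (d : ℕ) : E1 d →L[ℝ] E1 d →L[ℝ] ℝ :=
  ∑ i, (ContinuousLinearMap.proj i : E1 d →L[ℝ] ℝ).smulRight
    (ContinuousLinearMap.proj i : E1 d →L[ℝ] ℝ)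

theorem dotL_apply {d : ℕ} (μ v : E1 d) : dotL d μ v = ∑ i, μ i * v i := by
  simp [dotL]

/-- The pairing `(μ,v) ↦ −μ₁·v₁ + μ₂·v₂` on `ℝ^d × ℝ^d`. -/
def dotL2 (d : ℕ) : E2 d →L[ℝ] E2 d →L[ℝ] ℝ :=
  ((ContinuousLinearMap.compL ℝ (E2 d) (E1 d) ℝ).flip (ContinuousLinearMap.snd ℝ _ _)).comp
      ((dotL d).comp (ContinuousLinearMap.snd ℝ _ _)) -
    ((ContinuousLinearMap.compL ℝ (E2 d) (E1 d) ℝ).flip (ContinuousLinearMap.fst ℝ _ _)).comp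
      ((dotL d).comp (ContinuousLinearMap.fst ℝ _ _))

theorem dotL2_apply {d : ℕ} (μ v : E2 d) :
    dotL2 d μ v = (∑ i, μ.2 i * v.2 i) - ∑ i, μ.1 i * v.1 i := by
  simp [dotL2, dotL_apply]

/-- The unmodulated part of the dual tensors. -/
def dualWindow (d : ℕ) (B : Fin d → Fin d → E1 d → ℝ) (g : E1 d → ℝ) (p γ : E2 d) : ℂ :=
  (starRingEnd ℂ) (magWindow d B g p.1 γ.1) * magWindow d B g p.2 γ.2

theorem gaborDual_eq {d : ℕ} (B : Fin d → Fin d → E1 d → ℝ) (g : E1 d → ℝ) (a b : Idx d)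
    (p : E2 d) :
    gaborDual d B g a b p =
      dualWindow d B g p (fun i => (a.1 i : ℝ), fun i => (b.1 i : ℝ)) *
        Complex.exp (Complex.I * ((dotL2 d (fun i => (a.2 i : ℝ), fun i => (b.2 i : ℝ))
          (p - (fun i => (a.1 i : ℝ), fun i => (b.1 i : ℝ))) : ℝ) : ℂ)) := by
  simp only [gaborDual, gabor, dualWindow, magWindow, dotL2_apply, map_mul, Prod.fst_sub,
    Prod.snd_sub, Pi.sub_apply]
  rw [Complex.ofReal_sub, mul_sub, Complex.exp_sub]
  have h : (starRingEnd ℂ) (Complex.exp (Complex.I *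
      ((∑ i, (a.2 i : ℝ) * (p.1 i - (a.1 i : ℝ)) : ℝ) : ℂ))) =
      Complex.exp (-(Complex.I * ((∑ i, (a.2 i : ℝ) * (p.1 i - (a.1 i : ℝ)) : ℝ) : ℂ))) := by
    rw [← Complex.exp_conj, map_mul, Complex.conj_I, Complex.conj_ofReal, neg_mul]
  rw [h, Complex.exp_neg]
  ring

theorem gaborTensor_eq {d : ℕ} (B : Fin d → Fin d → E1 d → ℝ) (g : E1 d → ℝ) (a b : Idx d)
    (p : E2 d) : gaborTensor d B g a b p = (starRingEnd ℂ) (gaborDual d B g a b p) := by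
  simp [gaborTensor, gaborDual]

variable {d : ℕ} {B : Fin d → Fin d → E1 d → ℝ} {g : E1 d → ℝ}

theorem hasTemperateGrowth_magWindow (hB : IsRegularMagneticField d B) (hg : IsWindow d g) :
    (fun p : E1 d × E1 d => magWindow d B g p.1 p.2).HasTemperateGrowth := by
  have hx : (Prod.fst : E1 d × E1 d → E1 d).HasTemperateGrowth :=
    (ContinuousLinearMap.fst ℝ (E1 d) (E1 d)).hasTemperateGrowth
  have hy : (Prod.snd : E1 d × E1 d → E1 d).HasTemperateGrowth :=
    (ContinuousLinearMap.snd ℝ (E1 d) (E1 d)).hasTemperateGrowth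
  have hgt : g.HasTemperateGrowth := hg.compactSupport.hasTemperateGrowth hg.smooth
  exact ((Function.HasTemperateGrowth.const _).mul
    (hasTemperateGrowth_exp_I_mul.comp (hasTemperateGrowth_magPhi hB))).mul
    (Function.Complex.hasTemperateGrowth_ofReal.comp (hgt.comp (hx.sub hy)))

theorem hasTemperateGrowth_fst_fst {E : Type*} [NormedAddCommGroup E] [NormedSpace ℝ E] :
    (fun p : (E × E) × (E × E) => (p.1.1, p.2.1)).HasTemperateGrowth :=
  (((ContinuousLinearMap.fst ℝ E E).comp (ContinuousLinearMap.fst ℝ (E × E) (E × E))).prod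
    ((ContinuousLinearMap.fst ℝ E E).comp
      (ContinuousLinearMap.snd ℝ (E × E) (E × E)))).hasTemperateGrowth

theorem hasTemperateGrowth_snd_snd {E : Type*} [NormedAddCommGroup E] [NormedSpace ℝ E] :
    (fun p : (E × E) × (E × E) => (p.1.2, p.2.2)).HasTemperateGrowth :=
  (((ContinuousLinearMap.snd ℝ E E).comp (ContinuousLinearMap.fst ℝ (E × E) (E × E))).prod
    ((ContinuousLinearMap.snd ℝ E E).comp
      (ContinuousLinearMap.snd ℝ (E × E) (E × E)))).hasTemperateGrowth

theorem hasTemperateGrowth_conj_mul {E : Type*} [NormedAddCommGroup E] [NormedSpace ℝ E]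
    {w : E × E → ℂ} (hw : w.HasTemperateGrowth) :
    (fun p : (E × E) × (E × E) => (starRingEnd ℂ) (w (p.1.1, p.2.1)) * w (p.1.2, p.2.2)
      ).HasTemperateGrowth := by
  have hc : (fun z : ℂ => (starRingEnd ℂ) z).HasTemperateGrowth :=
    (Complex.conjCLE : ℂ →L[ℝ] ℂ).hasTemperateGrowth
  exact (hc.comp (hw.comp hasTemperateGrowth_fst_fst)).mul (hw.comp hasTemperateGrowth_snd_snd)

theorem hasTemperateGrowth_dualWindow (hB : IsRegularMagneticField d B) (hg : IsWindow d g) :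
    (fun p : E2 d × E2 d => dualWindow d B g p.1 p.2).HasTemperateGrowth :=
  hasTemperateGrowth_conj_mul (hasTemperateGrowth_magWindow hB hg)

theorem magWindow_support (hg : IsWindow d g) {x γ : E1 d} (h : magWindow d B g x γ ≠ 0)
    (i : Fin d) : |x i - γ i| < 1 := by
  refine hg.support_subset (x - γ) (fun h0 => h ?_) i
  simp [magWindow, h0]

theorem dualWindow_support (hg : IsWindow d g) {p γ : E2 d} (h : dualWindow d B g p γ ≠ 0) :
    (∀ i, |p.1 i - γ.1 i| < 1) ∧ ∀ i, |p.2 i - γ.2 i| < 1 := by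
  refine ⟨magWindow_support (B := B) hg fun h0 => h ?_,
    magWindow_support (B := B) hg fun h0 => h ?_⟩
  · simp [dualWindow, h0]
  · simp [dualWindow, h0]

theorem dualWindow_support_norm (hg : IsWindow d g) {p γ : E2 d}
    (h : dualWindow d B g p γ ≠ 0) : ‖p - γ‖ ≤ 1 := by
  obtain ⟨h1, h2⟩ := dualWindow_support hg h
  rw [Prod.norm_def]
  exact max_le ((pi_norm_le_iff_of_nonneg zero_le_one).2 fun i => (h1 i).le)
    ((pi_norm_le_iff_of_nonneg zero_le_one).2 fun i => (h2 i).le)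

theorem magWindow_mul_conj (x γ : E1 d) :
    magWindow d B g x γ * (starRingEnd ℂ) (magWindow d B g x γ) =
      (((2 * Real.pi) ^ (-(d : ℝ)) * g (x - γ) ^ 2 : ℝ) : ℂ) := by
  rw [Complex.mul_conj, Complex.normSq_eq_norm_sq]
  congr 1
  have h1 : ‖Complex.exp (Complex.I * (magPhi d B x γ : ℂ))‖ = 1 := by
    rw [mul_comm, Complex.norm_exp_ofReal_mul_I]
  have h0 : (0:ℝ) < 2 * Real.pi := by positivity
  rw [magWindow, norm_mul, norm_mul, h1, Complex.norm_real, Complex.norm_real, mul_one, mul_pow,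
    Real.norm_eq_abs, Real.norm_eq_abs, sq_abs, sq_abs, ← Real.rpow_natCast, ← Real.rpow_mul h0.le]
  congr 2
  push_cast
  ring

theorem dualWindow_mul_conj (p γ : E2 d) :
    dualWindow d B g p γ * (starRingEnd ℂ) (dualWindow d B g p γ) =
      (((2 * Real.pi) ^ (-(2 * d : ℝ)) * (g (p.1 - γ.1) ^ 2 * g (p.2 - γ.2) ^ 2) : ℝ) : ℂ) := by
  have h0 : (0:ℝ) < 2 * Real.pi := by positivity
  have h1 := magWindow_mul_conj (B := B) (g := g) p.1 γ.1
  have h2 := magWindow_mul_conj (B := B) (g := g) p.2 γ.2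
  have h3 : (2 * Real.pi) ^ (-(2 * d : ℝ)) =
      (2 * Real.pi) ^ (-(d : ℝ)) * (2 * Real.pi) ^ (-(d : ℝ)) := by
    rw [← Real.rpow_add h0]; congr 1; ring
  calc _ = (magWindow d B g p.1 γ.1 * (starRingEnd ℂ) (magWindow d B g p.1 γ.1)) *
      (magWindow d B g p.2 γ.2 * (starRingEnd ℂ) (magWindow d B g p.2 γ.2)) := by
        simp only [dualWindow, map_mul, Complex.conj_conj]; ring
    _ = _ := by rw [h1, h2, h3]; push_cast; ring

end GaborTemperateGrowth

section Modulation

variable {V : Type*} [NormedAddCommGroup V] [NormedSpace ℝ V]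

/-- Modulated window. -/
def modulated (L : V →L[ℝ] V →L[ℝ] ℝ) (w : V → V → ℂ) (p γ μ : V) : ℂ :=
  w p γ * Complex.exp (Complex.I * ((L μ (p - γ) : ℝ) : ℂ))

theorem hasTemperateGrowth_modulated (L : V →L[ℝ] V →L[ℝ] ℝ) {w : V → V → ℂ}
    (hw : (fun p : V × V => w p.1 p.2).HasTemperateGrowth) :
    (fun p : V × (V × V) => modulated L w p.1 p.2.1 p.2.2).HasTemperateGrowth := by
  have h1 : (fun p : V × (V × V) => p.1).HasTemperateGrowth :=
    (ContinuousLinearMap.fst ℝ V (V × V)).hasTemperateGrowth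
  have h2 : (fun p : V × (V × V) => p.2).HasTemperateGrowth :=
    (ContinuousLinearMap.snd ℝ V (V × V)).hasTemperateGrowth
  have h3 : (fun p : V × (V × V) => p.2.1).HasTemperateGrowth :=
    (ContinuousLinearMap.fst ℝ V V).hasTemperateGrowth.comp h2
  have h4 : (fun p : V × (V × V) => p.2.2).HasTemperateGrowth :=
    (ContinuousLinearMap.snd ℝ V V).hasTemperateGrowth.comp h2
  have h5 : (fun p : V × (V × V) => (p.1, p.2.1)).HasTemperateGrowth :=
    hasTemperateGrowth_prodMk h1 h3
  have h6 : (fun p : V × (V × V) => L p.2.2 (p.1 - p.2.1)).HasTemperateGrowth :=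
    L.bilinear_hasTemperateGrowth h4 (h1.sub h3)
  exact (hw.comp h5).mul (hasTemperateGrowth_exp_I_mul.comp h6)

theorem exists_pow_mul_iteratedFDeriv_slice_le {W F : Type*} [NormedAddCommGroup W]
    [NormedSpace ℝ W] [NormedAddCommGroup F] [NormedSpace ℝ F] {f : V × W → F}
    (hf : f.HasTemperateGrowth) (hs : ∀ p w, f (p, w) ≠ 0 → ‖p‖ ≤ 1 + ‖w‖) (k n : ℕ) :
    ∃ (C : ℝ) (N : ℕ), 0 ≤ C ∧ ∀ w p,
      ‖p‖ ^ k * ‖iteratedFDeriv ℝ n (fun p => f (p, w)) p‖ ≤ C * (1 + ‖w‖) ^ N := by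
  obtain ⟨m, C, hC, h⟩ := hf.norm_iteratedFDeriv_le_uniform n
  refine ⟨C * 2 ^ m, k + m, by positivity, fun w p => ?_⟩
  by_cases hz : iteratedFDeriv ℝ n (fun p => f (p, w)) p = 0
  · rw [hz, norm_zero, mul_zero]; positivity
  have hp : ‖p‖ ≤ 1 + ‖w‖ := by
    have h1 : p ∈ tsupport (fun p => f (p, w)) :=
      support_iteratedFDeriv_subset n hz
    have h2 : tsupport (fun p => f (p, w)) ⊆ {p | ‖p‖ ≤ 1 + ‖w‖} :=
      closure_minimal (fun p hp => hs p w hp) (isClosed_le continuous_norm continuous_const)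
    exact h2 h1
  have hslice : ‖iteratedFDeriv ℝ n (fun p => f (p, w)) p‖ ≤ ‖iteratedFDeriv ℝ n f (p, w)‖ := by
    have h3 : (fun p => f (p, w)) =
        (fun z => f (z + (0, w))) ∘ (ContinuousLinearMap.inl ℝ V W) := by
      funext p; simp
    have h5 : ContDiff ℝ (⊤ : ℕ∞) (fun z => f (z + (0, w))) :=
      hf.1.comp (contDiff_id.add contDiff_const)
    rw [h3, ContinuousLinearMap.iteratedFDeriv_comp_right (i := n) _ h5 _
      (by exact_mod_cast le_top)]
    refine (ContinuousMultilinearMap.norm_compContinuousLinearMap_le _ _).trans ?_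
    rw [iteratedFDeriv_comp_add_right]
    have h4 : (ContinuousLinearMap.inl ℝ V W p + (0, w)) = (p, w) := by simp
    rw [h4]
    refine mul_le_of_le_one_right (norm_nonneg _) ?_
    exact Finset.prod_le_one (fun _ _ => norm_nonneg _)
      fun _ _ => ContinuousLinearMap.norm_inl_le_one ℝ V W
  have hpw : 1 + ‖(p, w)‖ ≤ 2 * (1 + ‖w‖) := by
    have : ‖(p, w)‖ ≤ 1 + ‖w‖ := by
      rw [Prod.norm_def]; exact max_le hp (by simp)
    linarith [norm_nonneg w]
  calc ‖p‖ ^ k * ‖iteratedFDeriv ℝ n (fun p => f (p, w)) p‖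
      ≤ (1 + ‖w‖) ^ k * (C * (1 + ‖(p, w)‖) ^ m) := by
        gcongr
        exact hslice.trans (h n le_rfl _)
    _ ≤ (1 + ‖w‖) ^ k * (C * (2 * (1 + ‖w‖)) ^ m) := by gcongr
    _ = _ := by rw [mul_pow, pow_add]; ring

end Modulation

section KernelSchwartz

variable {V : Type*} [NormedAddCommGroup V] [NormedSpace ℝ V]

theorem exists_schwartzMap_mul_comp_fst {w : V × V → ℂ} (hw : w.HasTemperateGrowth)
    (hs : ∀ p γ, w (p, γ) ≠ 0 → ‖p - γ‖ ≤ 1) (H : SchwartzMap V ℂ) :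
    ∃ K : SchwartzMap (V × V) ℂ, ∀ p γ, K (p, γ) = w (p, γ) * H p := by
  have hH : ContDiff ℝ (⊤ : ℕ∞) (fun z : V × V => H z.1) := (H.smooth ⊤).comp contDiff_fst
  refine ⟨⟨fun z => w z * H z.1, hw.1.mul hH, fun k n => ?_⟩, fun p γ => rfl⟩
  obtain ⟨m, C, hC, h⟩ := hw.norm_iteratedFDeriv_le_uniform n
  set S : ℝ := 2 ^ (k + m) * ((Finset.Iic ((k + m, n) : ℕ × ℕ)).sup
    (fun l => SchwartzMap.seminorm ℝ l.1 l.2)) H with hS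
  have hS0 : 0 ≤ S := by positivity
  refine ⟨2 ^ (k + m) * ∑ i ∈ Finset.range (n + 1), (n.choose i : ℝ) * C * S, fun z => ?_⟩
  by_cases hz : iteratedFDeriv ℝ n (fun z : V × V => w z * H z.1) z = 0
  · rw [hz, norm_zero, mul_zero]; positivity
  have hp : ‖z.1 - z.2‖ ≤ 1 := by
    have h1 : z ∈ tsupport (fun z : V × V => w z * H z.1) :=
      support_iteratedFDeriv_subset n hz
    have h2 : tsupport (fun z : V × V => w z * H z.1) ⊆ {z | ‖z.1 - z.2‖ ≤ 1} :=
      closure_minimal (fun p hp => hs p.1 p.2 (left_ne_zero_of_mul hp))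
        (isClosed_le (by fun_prop) continuous_const)
    exact h2 h1
  have hz1 : 1 + ‖z‖ ≤ 2 * (1 + ‖z.1‖) := by
    have h2 : ‖z.2‖ ≤ ‖z.1‖ + ‖z.1 - z.2‖ := by
      have := norm_sub_le z.1 (z.1 - z.2); simpa using this
    have : ‖z‖ ≤ 1 + ‖z.1‖ := by
      rw [Prod.norm_def]; exact max_le (by linarith) (by linarith)
    linarith [norm_nonneg z.1]
  have hHd : ∀ j ≤ n, (1 + ‖z.1‖) ^ (k + m) * ‖iteratedFDeriv ℝ j (fun z : V × V => H z.1) z‖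
      ≤ S := by
    intro j hj
    have h3 : (fun z : V × V => H z.1) = H ∘ (ContinuousLinearMap.fst ℝ V V) := rfl
    rw [h3, ContinuousLinearMap.iteratedFDeriv_comp_right (i := j) _ (H.smooth ⊤) _
      (by exact_mod_cast le_top)]
    refine le_trans ?_ (SchwartzMap.one_add_le_sup_seminorm_apply (𝕜 := ℝ) (m := (k + m, n))
      (k := k + m) (n := j) le_rfl hj H z.1)
    gcongr
    refine (ContinuousMultilinearMap.norm_compContinuousLinearMap_le _ _).trans ?_
    refine mul_le_of_le_one_right (norm_nonneg _) ?_
    exact Finset.prod_le_one (fun _ _ => norm_nonneg _)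
      fun _ _ => ContinuousLinearMap.norm_fst_le ℝ V V
  have hL := norm_iteratedFDeriv_mul_le (𝕜 := ℝ) hw.1 hH z (n := n) (by exact_mod_cast le_top)
  calc ‖z‖ ^ k * ‖iteratedFDeriv ℝ n (fun z : V × V => w z * H z.1) z‖
      ≤ (1 + ‖z‖) ^ k * ∑ i ∈ Finset.range (n + 1), (n.choose i : ℝ) *
          ‖iteratedFDeriv ℝ i w z‖ * ‖iteratedFDeriv ℝ (n - i) (fun z : V × V => H z.1) z‖ := by
        gcongr
        simp
    _ ≤ (1 + ‖z‖) ^ k * ∑ i ∈ Finset.range (n + 1), (n.choose i : ℝ) *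
          (C * (1 + ‖z‖) ^ m) * ‖iteratedFDeriv ℝ (n - i) (fun z : V × V => H z.1) z‖ := by
        gcongr with i hi
        exact h i (Nat.lt_succ_iff.1 (Finset.mem_range.1 hi)) z
    _ = ∑ i ∈ Finset.range (n + 1), (n.choose i : ℝ) * C *
          ((1 + ‖z‖) ^ (k + m) * ‖iteratedFDeriv ℝ (n - i) (fun z : V × V => H z.1) z‖) := by
        rw [Finset.mul_sum]
        refine Finset.sum_congr rfl fun i _ => ?_
        rw [pow_add]; ring
    _ ≤ ∑ i ∈ Finset.range (n + 1), (n.choose i : ℝ) * C * (2 ^ (k + m) * S) := by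
        refine Finset.sum_le_sum fun i _ => mul_le_mul_of_nonneg_left ?_ (by positivity)
        calc _ ≤ (2 * (1 + ‖z.1‖)) ^ (k + m) *
              ‖iteratedFDeriv ℝ (n - i) (fun z : V × V => H z.1) z‖ := by gcongr
          _ = 2 ^ (k + m) * ((1 + ‖z.1‖) ^ (k + m) *
              ‖iteratedFDeriv ℝ (n - i) (fun z : V × V => H z.1) z‖) := by rw [mul_pow]; ring
          _ ≤ _ := mul_le_mul_of_nonneg_left (hHd _ (Nat.sub_le _ _)) (by positivity)
    _ = _ := by
        rw [Finset.mul_sum]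
        refine Finset.sum_congr rfl fun i _ => ?_
        ring

end KernelSchwartz

section OscillatoryDecay

variable {V : Type*} [NormedAddCommGroup V] [NormedSpace ℝ V]

/-- The restriction of a Schwartz function on `V × V` to the slice `V × {γ}`. -/
def schwartzSlice (K : SchwartzMap (V × V) ℂ) (γ : V) : SchwartzMap V ℂ :=
  SchwartzMap.compCLM ℝ (g := fun p : V => (p, γ))
    (hasTemperateGrowth_prodMk (ContinuousLinearMap.id ℝ V).hasTemperateGrowth (.const γ))
    ⟨1, 1, fun p => by
      have := le_max_left ‖p‖ ‖γ‖
      rw [Prod.norm_def, one_mul, pow_one]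
      linarith⟩ K

@[simp] theorem schwartzSlice_apply (K : SchwartzMap (V × V) ℂ) (γ p : V) :
    schwartzSlice K γ p = K (p, γ) := rfl

open scoped LineDeriv

theorem fderiv_schwartzSlice (K : SchwartzMap (V × V) ℂ) (γ p v : V) :
    fderiv ℝ (schwartzSlice K γ) p v = schwartzSlice (∂_{(v, (0 : V))} K) γ p := by
  have h1 : HasFDerivAt (fun p : V => (p, γ)) (ContinuousLinearMap.inl ℝ V V) p :=
    hasFDerivAt_prodMk_left p γ
  have h2 := (K.differentiableAt (x := (p, γ))).hasFDerivAt.comp p h1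
  have h3 : HasFDerivAt (schwartzSlice K γ)
    ((fderiv ℝ K (p, γ)).comp (ContinuousLinearMap.inl ℝ V V)) p := h2
  rw [h3.fderiv, schwartzSlice_apply, SchwartzMap.lineDerivOp_apply_eq_fderiv]
  rfl

variable [FiniteDimensional ℝ V] [MeasurableSpace V] [BorelSpace V] (ν : Measure V)
  [ν.IsAddHaarMeasure]

/-- The oscillatory integral `∫ e^{−i L(ξ, p−γ)} K(p,γ) dp`. -/
def oscIntegral (L : V →L[ℝ] V →L[ℝ] ℝ) (K : SchwartzMap (V × V) ℂ) (γ ξ : V) : ℂ :=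
  ∫ p, Complex.exp (-(Complex.I * ((L ξ (p - γ) : ℝ) : ℂ))) * K (p, γ) ∂ν

theorem norm_exp_neg_I_mul (t : ℝ) : ‖Complex.exp (-(Complex.I * (t : ℂ)))‖ = 1 := by
  have : -(Complex.I * (t : ℂ)) = ((-t : ℝ) : ℂ) * Complex.I := by push_cast; ring
  rw [this, Complex.norm_exp_ofReal_mul_I]

theorem integrable_exp_mul_schwartzMap (l : V →L[ℝ] ℝ) (γ : V) (f : SchwartzMap V ℂ) :
    Integrable (fun p => Complex.exp (-(Complex.I * ((l (p - γ) : ℝ) : ℂ))) * f p) ν := by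
  have hf : Integrable f ν := f.integrable
  refine hf.norm.mono' (Continuous.aestronglyMeasurable ?_) (ae_of_all _ fun p => ?_)
  · have := f.continuous
    fun_prop
  · rw [norm_mul, norm_exp_neg_I_mul, one_mul]

theorem mul_oscIntegral (L : V →L[ℝ] V →L[ℝ] ℝ) (K : SchwartzMap (V × V) ℂ) (γ ξ v : V) :
    ‖oscIntegral ν L (∂_{(v, (0 : V))} K) γ ξ‖ = |L ξ v| * ‖oscIntegral ν L K γ ξ‖ := by
  have hd : ∀ p, HasFDerivAt (fun p => Complex.exp (-(Complex.I * ((L ξ (p - γ) : ℝ) : ℂ))))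
      (Complex.exp (-(Complex.I * ((L ξ (p - γ) : ℝ) : ℂ))) •
        (-(Complex.I • Complex.ofRealCLM.comp (L ξ)))) p := by
    intro p
    refine HasFDerivAt.cexp ?_
    refine HasFDerivAt.neg ?_
    refine HasFDerivAt.const_mul (𝔸 := ℂ) ?_ _
    exact Complex.ofRealCLM.hasFDerivAt.comp p
      ((L ξ).hasFDerivAt.comp p ((hasFDerivAt_id p).sub_const γ))
  have hfd : ∀ p, fderiv ℝ (fun p => Complex.exp (-(Complex.I * ((L ξ (p - γ) : ℝ) : ℂ)))) p v =
      (-(Complex.I * (L ξ v : ℂ))) * Complex.exp (-(Complex.I * ((L ξ (p - γ) : ℝ) : ℂ))) := by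
    intro p
    rw [(hd p).fderiv]
    simp
    ring
  have key := integral_mul_fderiv_eq_neg_fderiv_mul_of_integrable (μ := ν) (v := v)
    (f := fun p => Complex.exp (-(Complex.I * ((L ξ (p - γ) : ℝ) : ℂ))))
    (g := schwartzSlice K γ) ?_ ?_ ?_ (fun p _ => (hd p).differentiableAt)
    (fun p _ => (schwartzSlice K γ).differentiableAt)
  · simp only [fderiv_schwartzSlice, hfd, mul_assoc] at key
    rw [integral_const_mul] at key
    change oscIntegral ν L (∂_{(v, (0 : V))} K) γ ξ =
      -(-(Complex.I * (L ξ v : ℂ)) * oscIntegral ν L K γ ξ) at key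
    rw [key, norm_neg, norm_mul]
    simp
  · simp only [hfd, mul_assoc]
    exact (integrable_exp_mul_schwartzMap ν (L ξ) γ _).const_mul _
  · simp only [fderiv_schwartzSlice]
    exact integrable_exp_mul_schwartzMap ν (L ξ) γ _
  · exact integrable_exp_mul_schwartzMap ν (L ξ) γ _

theorem exists_pow_mul_norm_oscIntegral_le (L : V →L[ℝ] V →L[ℝ] ℝ) (K : SchwartzMap (V × V) ℂ)
    (M : ℕ) : ∃ C, ∀ γ ξ, (1 + ‖γ‖) ^ M * ‖oscIntegral ν L K γ ξ‖ ≤ C := by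
  set r := ν.integrablePower with hr
  set S : ℝ := 2 ^ (M + r) * ((Finset.Iic ((M + r, 0) : ℕ × ℕ)).sup
    (fun l => SchwartzMap.seminorm ℝ l.1 l.2)) K with hS
  have h_int : Integrable (fun p : V => S * (1 + ‖p‖) ^ (-(r : ℝ))) ν :=
    (Measure.integrable_pow_neg_integrablePower ν).const_mul S
  refine ⟨∫ p, S * (1 + ‖p‖) ^ (-(r : ℝ)) ∂ν, fun γ ξ => ?_⟩
  have h0 : (0 : ℝ) < (1 + ‖γ‖) ^ M := by positivity
  rw [← abs_of_pos h0, ← Real.norm_eq_abs, ← Complex.norm_real, ← norm_mul, oscIntegral,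
    ← integral_const_mul]
  refine norm_integral_le_of_norm_le h_int (ae_of_all _ fun p => ?_)
  rw [norm_mul, norm_mul, norm_exp_neg_I_mul, one_mul, Complex.norm_real, Real.norm_eq_abs,
    abs_of_pos h0, Real.rpow_neg (by positivity), Real.rpow_natCast, ← div_eq_mul_inv,
    le_div_iff₀ (by positivity)]
  have h1 := SchwartzMap.one_add_le_sup_seminorm_apply (𝕜 := ℝ) (m := (M + r, 0))
      (k := M + r) (n := 0) le_rfl le_rfl K (p, γ)
  rw [norm_iteratedFDeriv_zero] at h1
  refine le_trans ?_ h1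
  rw [pow_add]
  have h2 : ‖γ‖ ≤ ‖(p, γ)‖ := le_max_right _ _
  have h3 : ‖p‖ ≤ ‖(p, γ)‖ := le_max_left _ _
  calc _ = (1 + ‖γ‖) ^ M * (1 + ‖p‖) ^ r * ‖K (p, γ)‖ := by ring
    _ ≤ _ := by gcongr

theorem exists_pow_mul_pow_mul_norm_oscIntegral_le (L : V →L[ℝ] V →L[ℝ] ℝ) {ι : Type*}
    [Fintype ι] (v : ι → V) (hv : ∀ ξ, ‖ξ‖ ≤ ∑ j, |L ξ (v j)|) (M N : ℕ) :
    ∀ K : SchwartzMap (V × V) ℂ,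
      ∃ C, ∀ γ ξ, (1 + ‖γ‖) ^ M * ‖ξ‖ ^ N * ‖oscIntegral ν L K γ ξ‖ ≤ C := by
  induction N with
  | zero => simpa using fun K => exists_pow_mul_norm_oscIntegral_le ν L K M
  | succ N ih =>
    intro K
    choose C hC using fun j => ih (∂_{(v j, (0 : V))} K)
    refine ⟨∑ j, C j, fun γ ξ => ?_⟩
    calc (1 + ‖γ‖) ^ M * ‖ξ‖ ^ (N + 1) * ‖oscIntegral ν L K γ ξ‖
        = (1 + ‖γ‖) ^ M * ‖ξ‖ ^ N * ‖oscIntegral ν L K γ ξ‖ * ‖ξ‖ := by ring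
      _ ≤ (1 + ‖γ‖) ^ M * ‖ξ‖ ^ N * ‖oscIntegral ν L K γ ξ‖ * ∑ j, |L ξ (v j)| := by
          gcongr; exact hv ξ
      _ = ∑ j, (1 + ‖γ‖) ^ M * ‖ξ‖ ^ N * (|L ξ (v j)| * ‖oscIntegral ν L K γ ξ‖) := by
          rw [Finset.mul_sum]
          exact Finset.sum_congr rfl fun j _ => by ring
      _ ≤ ∑ j, C j := by
          refine Finset.sum_le_sum fun j _ => ?_
          rw [← mul_oscIntegral]
          exact hC j γ ξ

theorem exists_norm_oscIntegral_le (L : V →L[ℝ] V →L[ℝ] ℝ) {ι : Type*}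
    [Fintype ι] (v : ι → V) (hv : ∀ ξ, ‖ξ‖ ≤ ∑ j, |L ξ (v j)|) (K : SchwartzMap (V × V) ℂ)
    (N : ℕ) : ∃ C, ∀ z : V × V, (1 + ‖z‖) ^ N * ‖oscIntegral ν L K z.1 z.2‖ ≤ C := by
  obtain ⟨C₀, h₀⟩ := exists_pow_mul_pow_mul_norm_oscIntegral_le ν L v hv N 0 K
  obtain ⟨C₁, h₁⟩ := exists_pow_mul_pow_mul_norm_oscIntegral_le ν L v hv N N K
  refine ⟨2 ^ (N - 1) * (C₀ + C₁), fun z => ?_⟩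
  have h2 : 1 + ‖z‖ ≤ (1 + ‖z.1‖) * (1 + ‖z.2‖) := by
    have := norm_nonneg z.1
    have := norm_nonneg z.2
    rw [Prod.norm_def]
    rcases max_cases ‖z.1‖ ‖z.2‖ with ⟨h, _⟩ | ⟨h, _⟩ <;> rw [h] <;> nlinarith
  have h3 : (1 + ‖z.2‖) ^ N ≤ 2 ^ (N - 1) * (1 ^ N + ‖z.2‖ ^ N) :=
    add_pow_le zero_le_one (norm_nonneg _) N
  calc (1 + ‖z‖) ^ N * ‖oscIntegral ν L K z.1 z.2‖
      ≤ ((1 + ‖z.1‖) * (1 + ‖z.2‖)) ^ N * ‖oscIntegral ν L K z.1 z.2‖ := by gcongr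
    _ ≤ (1 + ‖z.1‖) ^ N * (2 ^ (N - 1) * (1 ^ N + ‖z.2‖ ^ N)) *
          ‖oscIntegral ν L K z.1 z.2‖ := by rw [mul_pow]; gcongr
    _ = 2 ^ (N - 1) * ((1 + ‖z.1‖) ^ N * ‖z.2‖ ^ 0 * ‖oscIntegral ν L K z.1 z.2‖ +
          (1 + ‖z.1‖) ^ N * ‖z.2‖ ^ N * ‖oscIntegral ν L K z.1 z.2‖) := by
        rw [one_pow]; ring
    _ ≤ _ := by gcongr; exacts [h₀ _ _, h₁ _ _]

end OscillatoryDecay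

section LatticeSummability

theorem exists_summable_one_add_norm_prod {ι κ E F G : Type*} [SeminormedAddCommGroup E]
    [SeminormedAddCommGroup F] [SeminormedAddCommGroup G] {f : ι → E} {g : κ → F} {h : ι × κ → G}
    (hf : ∃ N : ℕ, Summable fun i => ((1 + ‖f i‖) ^ N)⁻¹)
    (hg : ∃ N : ℕ, Summable fun i => ((1 + ‖g i‖) ^ N)⁻¹)
    (h1 : ∀ i, ‖f i.1‖ ≤ ‖h i‖) (h2 : ∀ i, ‖g i.2‖ ≤ ‖h i‖) :
    ∃ N : ℕ, Summable fun i => ((1 + ‖h i‖) ^ N)⁻¹ := by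
  obtain ⟨N, hN⟩ := hf
  obtain ⟨M, hM⟩ := hg
  refine ⟨N + M, .of_nonneg_of_le (fun i => by positivity) (fun i => ?_)
    (hN.mul_of_nonneg hM (fun i => by positivity) (fun i => by positivity))⟩
  rw [← mul_inv, pow_add]
  have := h1 i
  have := h2 i
  gcongr

theorem exists_summable_one_add_norm_int :
    ∃ N : ℕ, Summable fun n : ℤ => ((1 + ‖(n : ℝ)‖) ^ N)⁻¹ := by
  refine ⟨2, ?_⟩
  have h : Summable fun n : ℤ => 1 / (|(n : ℝ)|) ^ 2 := by
    simpa using Real.summable_one_div_int_pow.2 one_lt_two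
  refine Summable.of_norm_bounded_eventually h ?_
  have : {(0 : ℤ)}ᶜ ∈ (cofinite : Filter ℤ) := (Set.finite_singleton 0).compl_mem_cofinite
  filter_upwards [this] with n hn
  have hn' : (0 : ℝ) < |(n : ℝ)| := by simpa using hn
  rw [Real.norm_of_nonneg (by positivity), one_div, Real.norm_eq_abs]
  gcongr
  linarith

theorem exists_summable_one_add_norm_pi_int (d : ℕ) :
    ∃ N : ℕ, Summable fun n : Fin d → ℤ => ((1 + ‖(fun i => (n i : ℝ))‖) ^ N)⁻¹ := by
  induction d with
  | zero => exact ⟨0, .of_finite⟩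
  | succ d ih =>
    obtain ⟨N, hN⟩ := exists_summable_one_add_norm_prod
      (h := fun x : ℤ × (Fin d → ℤ) =>
        (fun i => (((Fin.consEquiv fun _ : Fin (d + 1) => ℤ) x i : ℤ) : ℝ) : Fin (d + 1) → ℝ))
      exists_summable_one_add_norm_int ih
      (fun x => norm_le_pi_norm (fun i => (((Fin.consEquiv fun _ : Fin (d + 1) => ℤ) x i : ℤ) : ℝ))
        0)
      (fun x => (pi_norm_le_iff_of_nonneg (norm_nonneg _)).2 fun i => norm_le_pi_norm
        (fun i => (((Fin.consEquiv fun _ : Fin (d + 1) => ℤ) x i : ℤ) : ℝ)) i.succ)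
    exact ⟨N, (Fin.consEquiv fun _ : Fin (d + 1) => ℤ).summable_iff.1 hN⟩

/-- The real phase space point `((α,β),(α',β'))` of the index `((α,α'),(β,β'))`. -/
def idxPoint {d : ℕ} (q : Idx2 d) : E2 d × E2 d :=
  ((fun i => (q.1.1 i : ℝ), fun i => (q.2.1 i : ℝ)),
    (fun i => (q.1.2 i : ℝ), fun i => (q.2.2 i : ℝ)))

theorem exists_summable_one_add_norm_idxPoint (d : ℕ) :
    ∃ N : ℕ, Summable fun q : Idx2 d => ((1 + ‖idxPoint q‖) ^ N)⁻¹ := by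
  have h1 := exists_summable_one_add_norm_pi_int d
  have h2 := exists_summable_one_add_norm_prod h1 h1
    (h := fun x : Idx d => ((fun i => (x.1 i : ℝ), fun i => (x.2 i : ℝ)) : E2 d))
    (fun _ => le_max_left _ _) (fun _ => le_max_right _ _)
  refine exists_summable_one_add_norm_prod h2 h2 (fun q => ?_) (fun q => ?_)
  · simp only [idxPoint, Prod.norm_def]
    exact max_le_max (le_max_left _ _) (le_max_left _ _)
  · simp only [idxPoint, Prod.norm_def]
    exact max_le_max (le_max_right _ _) (le_max_right _ _)

end LatticeSummability

section SchwartzSeries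

theorem SchwartzMap.hasSum_of_summable_seminorm {ι E : Type*} [NormedAddCommGroup E]
    [NormedSpace ℝ E] {f : ι → SchwartzMap E ℂ} {H : SchwartzMap E ℂ}
    (hf : ∀ k n : ℕ, Summable fun i => SchwartzMap.seminorm ℝ k n (f i))
    (hH : ∀ x, HasSum (fun i => f i x) (H x)) : HasSum f H := by
  have hderiv : ∀ (n : ℕ) (x : E), iteratedFDeriv ℝ n H x = ∑' i, iteratedFDeriv ℝ n (f i) x := by
    intro n x
    have h1 : (H : E → ℂ) = fun x => ∑' i, f i x := funext fun x => (hH x).tsum_eq.symm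
    rw [h1]
    exact iteratedFDeriv_tsum_apply (N := ⊤) (fun i => (f i).smooth ⊤) (fun k _ => hf 0 k)
      (fun k i x _ => SchwartzMap.norm_iteratedFDeriv_le_seminorm ℝ (f i) k x) le_top x
  have hsum : ∀ (n : ℕ) (x : E), Summable fun i => iteratedFDeriv ℝ n (f i) x := fun n x =>
    .of_norm_bounded (hf 0 n) fun i => SchwartzMap.norm_iteratedFDeriv_le_seminorm ℝ (f i) n x
  refine ((schwartz_withSeminorms ℝ E ℂ).tendsto_nhds _ _).2 fun ⟨k, n⟩ ε hε => ?_
  filter_upwards [(tendsto_order.1 (tendsto_tsum_compl_atTop_zero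
    fun i => SchwartzMap.seminorm ℝ k n (f i))).2 _ hε] with s hs
  refine lt_of_le_of_lt ?_ hs
  rw [map_sub_rev]
  refine SchwartzMap.seminorm_le_bound ℝ k n _ (tsum_nonneg fun i => apply_nonneg _ _) fun x => ?_
  have h2 : iteratedFDeriv ℝ n (⇑(H - ∑ i ∈ s, f i)) x =
      ∑' i : {i // i ∉ s}, iteratedFDeriv ℝ n (f i) x := by
    have h3 : ⇑(H - ∑ i ∈ s, f i) = ⇑H - fun x => ∑ i ∈ s, f i x := by
      funext x
      simp
    rw [h3, iteratedFDeriv_sub_apply ((H.smooth n).contDiffAt)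
      (ContDiff.sum fun i _ => (f i).smooth n).contDiffAt,
      iteratedFDeriv_fun_sum_apply fun i _ => ((f i).smooth n).contDiffAt, hderiv,
      ← (hsum n x).sum_add_tsum_subtype_compl s, add_sub_cancel_left]
  rw [h2]
  have h4 : Summable fun i : {i // i ∉ s} => ‖iteratedFDeriv ℝ n (f i) x‖ :=
    (Summable.of_nonneg_of_le (fun _ => norm_nonneg _)
      (fun i => SchwartzMap.norm_iteratedFDeriv_le_seminorm ℝ (f i) n x) (hf 0 n)).subtype _
  calc ‖x‖ ^ k * ‖∑' i : {i // i ∉ s}, iteratedFDeriv ℝ n (f i) x‖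
      ≤ ‖x‖ ^ k * ∑' i : {i // i ∉ s}, ‖iteratedFDeriv ℝ n (f i) x‖ := by
        gcongr
        exact norm_tsum_le_tsum_norm h4
    _ = ∑' i : {i // i ∉ s}, ‖x‖ ^ k * ‖iteratedFDeriv ℝ n (f i) x‖ := by rw [tsum_mul_left]
    _ ≤ _ := (h4.mul_left _).tsum_le_tsum (fun i => SchwartzMap.le_seminorm ℝ k n (f i) x)
        ((hf k n).subtype _)

end SchwartzSeries

section FourierInversion

variable {ι : Type*}

/-- The representative in `(-π, π]^ι` of a point of the unit torus. -/
def torusRep (z : UnitAddTorus ι) : ι → ℝ :=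
  fun i => 2 * Real.pi * (AddCircle.equivIoc (1 : ℝ) (-1 / 2) (z i) : ℝ)

theorem torusRep_coe {x : ι → ℝ} (hx : ∀ i, x i ∈ Set.Ioc (-1 / 2 : ℝ) (-1 / 2 + 1)) :
    torusRep (fun i => (x i : UnitAddCircle)) = (2 * Real.pi) • x := by
  funext i
  simp only [torusRep, Pi.smul_apply, smul_eq_mul]
  rw [AddCircle.equivIoc_coe_eq (hx i)]

theorem norm_eq_abs_equivIoc (z : UnitAddCircle) :
    ‖z‖ = |(AddCircle.equivIoc (1 : ℝ) (-1 / 2) z : ℝ)| := by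
  have h := (AddCircle.equivIoc (1 : ℝ) (-1 / 2) z).2
  conv_lhs => rw [← AddCircle.coe_equivIoc (p := (1 : ℝ)) (a := -1 / 2) (y := z)]
  rw [AddCircle.norm_coe_eq_abs_iff _ one_ne_zero, abs_le]
  constructor <;> norm_num <;> linarith [h.1, h.2]

variable [Fintype ι]

theorem continuous_comp_torusRep {h : (ι → ℝ) → ℂ} (hc : Continuous h)
    (hs : ∀ x, h x ≠ 0 → ∀ i, |x i| ≤ 1) : Continuous fun z : UnitAddTorus ι => h (torusRep z) := by
  refine continuous_iff_continuousAt.2 fun z => ?_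
  by_cases hz : ∀ i, z i ≠ ((-1 / 2 : ℝ) : UnitAddCircle)
  · refine hc.continuousAt.comp (continuousAt_pi.2 fun i => ?_)
    have h1 : ContinuousAt (fun w : UnitAddTorus ι =>
        AddCircle.equivIoc (1 : ℝ) (-1 / 2) (w i)) z :=
      ContinuousAt.comp (f := fun w : UnitAddTorus ι => w i)
        (AddCircle.continuousAt_equivIoc 1 (-1 / 2) (hz i)) (continuous_apply i).continuousAt
    exact continuousAt_const.mul (continuousAt_subtype_val.comp h1)
  · push Not at hz
    obtain ⟨i, hi⟩ := hz
    have h1 : ‖z i‖ = 1 / 2 := by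
      rw [hi, (AddCircle.norm_coe_eq_abs_iff (1 : ℝ) one_ne_zero).2] <;> norm_num [abs_div]
    have h2 : ∀ᶠ y in nhds z, 1 / 3 < ‖y i‖ :=
      (continuous_norm.comp (continuous_apply i)).continuousAt.eventually
        (lt_mem_nhds (by simp only [Function.comp]; rw [h1]; norm_num))
    have h3 : ∀ᶠ y in nhds z, h (torusRep y) = 0 := by
      filter_upwards [h2] with y hy
      by_contra h0
      have h4 := hs _ h0 i
      rw [norm_eq_abs_equivIoc] at hy
      rw [torusRep, abs_mul, abs_of_pos Real.two_pi_pos] at h4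
      nlinarith [Real.pi_gt_three]
    exact continuousAt_const.congr (h3.mono fun y hy => hy.symm)

theorem mFourier_coe (n : ι → ℤ) (x : ι → ℝ) :
    UnitAddTorus.mFourier n (fun i => (x i : UnitAddCircle)) =
      Complex.exp (Complex.I * ((∑ i, (n i : ℝ) * (2 * Real.pi * x i) : ℝ) : ℂ)) := by
  simp only [UnitAddTorus.mFourier, ContinuousMap.coe_mk, fourier_coe_apply]
  rw [← Complex.exp_sum]
  congr 1
  push_cast
  rw [Finset.mul_sum]
  refine Finset.sum_congr rfl fun i _ => ?_
  simp
  ring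

theorem mFourierCoeff_comp_torusRep {h : (ι → ℝ) → ℂ}
    (hs : ∀ x, h x ≠ 0 → ∀ i, |x i| ≤ 1) (n : ι → ℤ) :
    UnitAddTorus.mFourierCoeff (fun z : UnitAddTorus ι => h (torusRep z)) n =
      (((2 * Real.pi) ^ Fintype.card ι)⁻¹ : ℝ) •
        ∫ x, Complex.exp (-(Complex.I * ((∑ i, (n i : ℝ) * x i : ℝ) : ℂ))) * h x := by
  rw [UnitAddTorus.mFourierCoeff_eq_integral _ n (fun _ => -1 / 2)]
  set G : (ι → ℝ) → ℂ := fun x =>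
    Complex.exp (-(Complex.I * ((∑ i, (n i : ℝ) * x i : ℝ) : ℂ))) * h x with hG
  have hm : MeasurableSet {x : ι → ℝ | ∀ i, x i ∈ Set.Ioc (-1 / 2 : ℝ) (-1 / 2 + 1)} :=
    MeasurableSet.univ_pi' (fun i => measurableSet_Ioc)
  have h1 : ∫ x in {x : ι → ℝ | ∀ i, x i ∈ Set.Ioc (-1 / 2 : ℝ) (-1 / 2 + 1)},
      UnitAddTorus.mFourier (-n) (fun i => (x i : UnitAddCircle)) •
        h (torusRep (fun i => (x i : UnitAddCircle))) =
      ∫ x in {x : ι → ℝ | ∀ i, x i ∈ Set.Ioc (-1 / 2 : ℝ) (-1 / 2 + 1)},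
        G ((2 * Real.pi) • x) := by
    refine setIntegral_congr_fun hm fun x hx => ?_
    simp only [hG]
    rw [torusRep_coe hx, mFourier_coe, smul_eq_mul]
    congr 2
    simp only [Pi.neg_apply, Int.cast_neg, neg_mul, Finset.sum_neg_distrib, Complex.ofReal_neg,
      mul_neg, Pi.smul_apply, smul_eq_mul]
  rw [h1, setIntegral_eq_integral_of_forall_compl_eq_zero, Measure.integral_comp_smul,
    Module.finrank_fintype_fun_eq_card, abs_of_pos (by positivity)]
  intro x hx
  by_contra h0
  have h2 := hs _ (right_ne_zero_of_mul h0)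
  refine hx fun i => ?_
  have h3 := h2 i
  rw [Pi.smul_apply, smul_eq_mul, abs_mul, abs_of_pos Real.two_pi_pos] at h3
  have h4 : |x i| < 1 / 2 := by nlinarith [Real.pi_gt_three]
  rw [abs_lt] at h4
  constructor <;> linarith [h4.1, h4.2]

theorem hasSum_fourier_of_support_subset {h : (ι → ℝ) → ℂ} (hc : Continuous h)
    (hs : ∀ x, h x ≠ 0 → ∀ i, |x i| ≤ 1)
    (hsum : Summable fun n : ι → ℤ =>
      ∫ x, Complex.exp (-(Complex.I * ((∑ i, (n i : ℝ) * x i : ℝ) : ℂ))) * h x)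
    (y : ι → ℝ) (hy : ∀ i, |y i| ≤ 1) :
    HasSum (fun n : ι → ℤ =>
      (∫ x, Complex.exp (-(Complex.I * ((∑ i, (n i : ℝ) * x i : ℝ) : ℂ))) * h x) *
        Complex.exp (Complex.I * ((∑ i, (n i : ℝ) * y i : ℝ) : ℂ)))
      ((2 * Real.pi) ^ Fintype.card ι * h y) := by
  have hpi := Real.pi_gt_three
  set f : C(UnitAddTorus ι, ℂ) := ⟨fun z => h (torusRep z), continuous_comp_torusRep hc hs⟩
  have hf : ∀ n, UnitAddTorus.mFourierCoeff f n = (((2 * Real.pi) ^ Fintype.card ι)⁻¹ : ℝ) •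
      ∫ x, Complex.exp (-(Complex.I * ((∑ i, (n i : ℝ) * x i : ℝ) : ℂ))) * h x :=
    mFourierCoeff_comp_torusRep hs
  have hb : ∀ i, ((2 * Real.pi)⁻¹ • y) i ∈ Set.Ioc (-1 / 2 : ℝ) (-1 / 2 + 1) := by
    intro i
    have h1 : |((2 * Real.pi)⁻¹ • y) i| < 1 / 2 := by
      rw [Pi.smul_apply, smul_eq_mul, abs_mul, abs_of_pos (by positivity),
        inv_mul_lt_iff₀ (by positivity)]
      linarith [hy i]
    rw [abs_lt] at h1
    constructor <;> linarith [h1.1, h1.2]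
  have key := UnitAddTorus.hasSum_mFourier_series_apply_of_summable (f := f)
    ((hsum.const_smul _).congr fun n => (hf n).symm)
    (fun i => ((((2 * Real.pi)⁻¹ • y) i : ℝ) : UnitAddCircle))
  have hfy : f (fun i => ((((2 * Real.pi)⁻¹ • y) i : ℝ) : UnitAddCircle)) = h y := by
    change h (torusRep _) = _
    rw [torusRep_coe hb, smul_smul, mul_inv_cancel₀ (by positivity), one_smul]
  rw [hfy] at key
  have h0 : (((2 * Real.pi) ^ Fintype.card ι : ℝ) : ℂ) ≠ 0 := by
    exact_mod_cast (by positivity : ((2 * Real.pi) ^ Fintype.card ι : ℝ) ≠ 0)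
  have hy' : ∀ n : ι → ℤ, ∑ i, (n i : ℝ) * (2 * Real.pi * ((2 * Real.pi)⁻¹ • y) i) =
      ∑ i, (n i : ℝ) * y i := fun n => Finset.sum_congr rfl fun i _ => by
    rw [Pi.smul_apply, smul_eq_mul, mul_inv_cancel_left₀ (by positivity)]
  convert! key.mul_left (((2 * Real.pi) ^ Fintype.card ι : ℝ) : ℂ) using 1
  · funext n
    rw [hf, mFourier_coe, Complex.real_smul, smul_eq_mul, Complex.ofReal_inv, ← mul_assoc,
      mul_inv_cancel_left₀ h0]
    rw [hy']
  · push_cast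
    rfl

end FourierInversion

section GaborInversion

variable {d : ℕ}

theorem norm_le_sum_abs_dotL2 (ξ : E2 d) :
    ‖ξ‖ ≤ ∑ j : Fin d ⊕ Fin d, |dotL2 d ξ (Sum.elim (fun i => (Pi.single i 1, 0))
      (fun i => (0, Pi.single i 1)) j)| := by
  have h1 : ∀ f : E1 d, ‖f‖ ≤ ∑ i, |f i| := fun f =>
    (pi_norm_le_iff_of_nonneg (by positivity)).2 fun i =>
      Finset.single_le_sum (f := fun i => |f i|) (fun _ _ => abs_nonneg _) (Finset.mem_univ i)
  have h2 : ∑ j : Fin d ⊕ Fin d, |dotL2 d ξ (Sum.elim (fun i => (Pi.single i 1, 0))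
      (fun i => (0, Pi.single i 1)) j)| = ∑ i, |ξ.1 i| + ∑ i, |ξ.2 i| := by
    rw [Fintype.sum_sum_type]
    simp [dotL2_apply, Pi.single_apply]
  rw [h2, Prod.norm_def]
  have h3 : 0 ≤ ∑ i, |ξ.1 i| := by positivity
  have h4 : 0 ≤ ∑ i, |ξ.2 i| := by positivity
  exact max_le (by linarith [h1 ξ.1]) (by linarith [h1 ξ.2])

/-- The real point of `ℝ^d × ℝ^d` given by a lattice point. -/
def latticePoint (m : Idx d) : E2 d := (fun i => (m.1 i : ℝ), fun i => (m.2 i : ℝ))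

/-- The identification of `ℤ^d × ℤ^d` with `ℤ^{2d}` which changes the sign of the first half. -/
def signedSumEquiv (d : ℕ) : Idx d ≃ (Fin d ⊕ Fin d → ℤ) :=
  ((Equiv.neg (Fin d → ℤ)).prodCongr (Equiv.refl _)).trans
    (Equiv.sumArrowEquivProdArrow (Fin d) (Fin d) ℤ).symm

theorem sum_signedSumEquiv_mul (m : Idx d) (x : Fin d ⊕ Fin d → ℝ) :
    ∑ i, (signedSumEquiv d m i : ℝ) * x i =
      dotL2 d (latticePoint m) (fun i => x (.inl i), fun i => x (.inr i)) := by
  rw [Fintype.sum_sum_type, dotL2_apply]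
  have h1 : ∀ i, signedSumEquiv d m (.inl i) = -m.1 i := fun _ => rfl
  have h2 : ∀ i, signedSumEquiv d m (.inr i) = m.2 i := fun _ => rfl
  simp only [h1, h2, latticePoint, Int.cast_neg, neg_mul, Finset.sum_neg_distrib]
  ring

instance isAddHaarMeasure_volume_E2 : (volume : Measure (E2 d)).IsAddHaarMeasure :=
  Measure.prod.instIsAddHaarMeasure _ _

theorem integral_sum_pi (f : E2 d → ℂ) :
    ∫ x : Fin d ⊕ Fin d → ℝ, f (fun i => x (.inl i), fun i => x (.inr i)) = ∫ z, f z :=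
  (volume_measurePreserving_sumPiEquivProdPi (fun _ : Fin d ⊕ Fin d => ℝ)).integral_comp'
    (g := f)

theorem hasSum_oscIntegral_mul_exp (K : SchwartzMap (E2 d × E2 d) ℂ) (γ : E2 d)
    (hs : ∀ p, K (p, γ) ≠ 0 → ‖p - γ‖ ≤ 1)
    (hsum : Summable fun m : Idx d => oscIntegral volume (dotL2 d) K γ (latticePoint m))
    {p : E2 d} (hp : ‖p - γ‖ ≤ 1) :
    HasSum (fun m : Idx d => oscIntegral volume (dotL2 d) K γ (latticePoint m) *
      Complex.exp (Complex.I * ((dotL2 d (latticePoint m) (p - γ) : ℝ) : ℂ)))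
      ((2 * Real.pi) ^ (d + d) * K (p, γ)) := by
  have hn : ∀ z : E2 d, ‖z‖ ≤ 1 ↔ ∀ i, |Sum.elim z.1 z.2 i| ≤ 1 := by
    intro z
    rw [Prod.norm_def, max_le_iff, pi_norm_le_iff_of_nonneg zero_le_one,
      pi_norm_le_iff_of_nonneg zero_le_one, Sum.forall]
    rfl
  set h : (Fin d ⊕ Fin d → ℝ) → ℂ :=
    fun x => K (((fun i => x (.inl i), fun i => x (.inr i)) : E2 d) + γ, γ) with hh
  have hc : Continuous h := by
    have := K.continuous
    fun_prop
  have hs' : ∀ x, h x ≠ 0 → ∀ i, |x i| ≤ 1 := by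
    intro x hx
    have h1 := (hn _).1 (hs _ hx)
    rw [add_sub_cancel_right] at h1
    rintro (i | i)
    · exact h1 (.inl i)
    · exact h1 (.inr i)
  have hI : ∀ m : Idx d, ∫ x, Complex.exp (-(Complex.I *
      ((∑ i, (signedSumEquiv d m i : ℝ) * x i : ℝ) : ℂ))) * h x =
      oscIntegral volume (dotL2 d) K γ (latticePoint m) := by
    intro m
    simp only [sum_signedSumEquiv_mul, hh]
    rw [integral_sum_pi (fun z => Complex.exp (-(Complex.I *
      ((dotL2 d (latticePoint m) z : ℝ) : ℂ))) * K (z + γ, γ)), oscIntegral,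
      ← integral_sub_right_eq_self (fun z => Complex.exp (-(Complex.I *
      ((dotL2 d (latticePoint m) z : ℝ) : ℂ))) * K (z + γ, γ)) γ]
    simp only [sub_add_cancel]
  have key := hasSum_fourier_of_support_subset hc hs'
    ((signedSumEquiv d).summable_iff.1 (hsum.congr fun m => (hI m).symm))
    (Sum.elim (p - γ).1 (p - γ).2) ((hn _).1 hp)
  rw [← (signedSumEquiv d).hasSum_iff] at key
  have h2 : h (Sum.elim (p - γ).1 (p - γ).2) = K (p, γ) := by
    simp only [hh, Sum.elim_inl, Sum.elim_inr, Prod.mk.eta, sub_add_cancel]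
  rw [h2, Fintype.card_sum, Fintype.card_fin] at key
  convert! key using 2 with m
  rw [Function.comp_apply, hI, sum_signedSumEquiv_mul]
  rfl

end GaborInversion

section GaborExpansion

variable {d : ℕ} {B : Fin d → Fin d → E1 d → ℝ} {g : E1 d → ℝ}

theorem IsWindow.hasSum (hg : IsWindow d g) (x : E1 d) :
    HasSum (fun α : Fin d → ℤ => g (x - fun i => (α i : ℝ)) ^ 2) 1 := by
  have h : Summable fun α : Fin d → ℤ => g (x - fun i => (α i : ℝ)) ^ 2 := by
    by_contra h0
    simpa [tsum_eq_zero_of_not_summable h0] using hg.partition x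
  simpa only [hg.partition x] using h.hasSum

theorem IsWindow.hasSum_mul (hg : IsWindow d g) (p : E2 d) :
    HasSum (fun a : Idx d => g (p.1 - (latticePoint a).1) ^ 2 * g (p.2 - (latticePoint a).2) ^ 2)
      1 := by
  have h1 := hg.hasSum p.1
  have h2 := hg.hasSum p.2
  have h3 := h1.mul h2 (h1.summable.mul_of_nonneg h2.summable
    (fun _ => sq_nonneg _) (fun _ => sq_nonneg _))
  rw [mul_one] at h3
  exact h3

theorem gaborDual_eq_modulated (q : Idx2 d) (p : E2 d) :
    gaborDual d B g q.1 q.2 p =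
      modulated (dotL2 d) (dualWindow d B g) p (idxPoint q).1 (idxPoint q).2 :=
  gaborDual_eq B g q.1 q.2 p

theorem exists_schwartzMap_conj_dualWindow_mul (hB : IsRegularMagneticField d B)
    (hg : IsWindow d g) (H : SchwartzMap (E2 d) ℂ) : ∃ K : SchwartzMap (E2 d × E2 d) ℂ,
      ∀ p γ, K (p, γ) = (starRingEnd ℂ) (dualWindow d B g p γ) * H p := by
  have hc : (fun z : ℂ => (starRingEnd ℂ) z).HasTemperateGrowth :=
    (Complex.conjCLE : ℂ →L[ℝ] ℂ).hasTemperateGrowth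
  exact exists_schwartzMap_mul_comp_fst
    (w := fun z => (starRingEnd ℂ) (dualWindow d B g z.1 z.2))
    (hc.comp (hasTemperateGrowth_dualWindow hB hg))
    (fun p γ h => dualWindow_support_norm (B := B) hg fun h0 => h (by simp [h0])) H

theorem integral_gaborTensor_mul {H : SchwartzMap (E2 d) ℂ} {K : SchwartzMap (E2 d × E2 d) ℂ}
    (hK : ∀ p γ, K (p, γ) = (starRingEnd ℂ) (dualWindow d B g p γ) * H p) (q : Idx2 d) :
    ∫ p : E2 d, gaborTensor d B g q.1 q.2 p * H p =
      oscIntegral volume (dotL2 d) K (idxPoint q).1 (idxPoint q).2 := by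
  refine integral_congr_ae (ae_of_all _ fun p => ?_)
  simp only [gaborTensor_eq, gaborDual_eq_modulated, modulated, hK, map_mul, ← Complex.exp_conj,
    Complex.conj_I, Complex.conj_ofReal, neg_mul]
  ring

theorem hasSum_oscIntegral_mul_modulated (hg : IsWindow d g) {H : SchwartzMap (E2 d) ℂ}
    {K : SchwartzMap (E2 d × E2 d) ℂ}
    (hK : ∀ p γ, K (p, γ) = (starRingEnd ℂ) (dualWindow d B g p γ) * H p)
    (hsum : Summable fun q : Idx2 d =>
      oscIntegral volume (dotL2 d) K (idxPoint q).1 (idxPoint q).2) {p : E2 d}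
    (hp : Summable fun q : Idx2 d => oscIntegral volume (dotL2 d) K (idxPoint q).1 (idxPoint q).2 *
      modulated (dotL2 d) (dualWindow d B g) p (idxPoint q).1 (idxPoint q).2) :
    HasSum (fun q : Idx2 d => oscIntegral volume (dotL2 d) K (idxPoint q).1 (idxPoint q).2 *
      modulated (dotL2 d) (dualWindow d B g) p (idxPoint q).1 (idxPoint q).2) (H p) := by
  set e : Idx d × Idx d ≃ Idx2 d := Equiv.prodProdProdComm _ _ _ _
  have hsum' : Summable fun x : Idx d × Idx d =>
      oscIntegral volume (dotL2 d) K (latticePoint x.1) (latticePoint x.2) :=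
    e.summable_iff.2 hsum
  have hp' : Summable fun x : Idx d × Idx d =>
      oscIntegral volume (dotL2 d) K (latticePoint x.1) (latticePoint x.2) *
        modulated (dotL2 d) (dualWindow d B g) p (latticePoint x.1) (latticePoint x.2) :=
    e.summable_iff.2 hp
  have hfib : ∀ a : Idx d, HasSum (fun m : Idx d =>
      oscIntegral volume (dotL2 d) K (latticePoint a) (latticePoint m) *
        modulated (dotL2 d) (dualWindow d B g) p (latticePoint a) (latticePoint m))
      (((g (p.1 - (latticePoint a).1) ^ 2 * g (p.2 - (latticePoint a).2) ^ 2 : ℝ) : ℂ) * H p) := by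
    intro a
    have h0 : (0 : ℝ) < 2 * Real.pi := by positivity
    have h1 := dualWindow_mul_conj (B := B) (g := g) p (latticePoint a)
    have hval : ((g (p.1 - (latticePoint a).1) ^ 2 * g (p.2 - (latticePoint a).2) ^ 2 : ℝ) : ℂ) *
        H p = dualWindow d B g p (latticePoint a) *
          ((2 * Real.pi) ^ (d + d) * K (p, latticePoint a)) := by
      have h2 : (2 * Real.pi) ^ (d + d) * (2 * Real.pi) ^ (-(2 * d : ℝ)) = 1 := by
        rw [← Real.rpow_natCast, ← Real.rpow_add h0, Nat.cast_add, ← two_mul (d : ℝ),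
          add_neg_cancel, Real.rpow_zero]
      have h3 : ((2 * Real.pi) ^ (d + d) : ℂ) * (((2 * Real.pi) ^ (-(2 * d : ℝ)) : ℝ) : ℂ) = 1 := by
        exact_mod_cast congrArg Complex.ofReal h2
      rw [hK, show ∀ a b c e : ℂ, a * (b * (c * e)) = b * (a * c) * e by intros; ring, h1,
        Complex.ofReal_mul ((2 * Real.pi) ^ (-(2 * d : ℝ))),
        ← mul_assoc ((2 * Real.pi : ℂ) ^ (d + d)), h3, one_mul]
    rw [hval]
    by_cases hw : dualWindow d B g p (latticePoint a) = 0
    · simp [modulated, hw]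
    · have h4 := (hasSum_oscIntegral_mul_exp K (latticePoint a)
        (fun p h => dualWindow_support_norm (B := B) hg fun h0 => h (by rw [hK, h0]; simp))
        (hsum'.prod_factor a) (dualWindow_support_norm hg hw)).mul_left
        (dualWindow d B g p (latticePoint a))
      simpa only [modulated, mul_left_comm] using h4
  have hout : HasSum (fun a : Idx d =>
      ((g (p.1 - (latticePoint a).1) ^ 2 * g (p.2 - (latticePoint a).2) ^ 2 : ℝ) : ℂ) * H p)
      (H p) := by
    simpa only [Complex.ofReal_one, one_mul] using
      (Complex.hasSum_ofReal.2 (hg.hasSum_mul p)).mul_right (H p)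
  have htot := hp'.hasSum
  rw [(htot.prod_fiberwise hfib).unique hout] at htot
  exact e.hasSum_iff.1 htot

theorem exists_seminorm_le_of_eq_gaborDual (hB : IsRegularMagneticField d B) (hg : IsWindow d g)
    {T : Idx2 d → SchwartzMap (E2 d) ℂ} (hT : ∀ q, ⇑(T q) = gaborDual d B g q.1 q.2) (k n : ℕ) :
    ∃ (C : ℝ) (N : ℕ), 0 ≤ C ∧ ∀ q,
      SchwartzMap.seminorm ℝ k n (T q) ≤ C * (1 + ‖idxPoint q‖) ^ N := by
  obtain ⟨C, N, hC, h⟩ := exists_pow_mul_iteratedFDeriv_slice_le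
    (hasTemperateGrowth_modulated (dotL2 d) (hasTemperateGrowth_dualWindow hB hg))
    (fun p w hw => by
      have h1 := dualWindow_support_norm hg (left_ne_zero_of_mul hw)
      have h2 : ‖p‖ ≤ ‖p - w.1‖ + ‖w.1‖ := by simpa using norm_add_le (p - w.1) w.1
      linarith [norm_fst_le w]) k n
  refine ⟨C, N, hC, fun q => SchwartzMap.seminorm_le_bound ℝ k n _ (by positivity) fun p => ?_⟩
  rw [hT, funext (gaborDual_eq_modulated q)]
  exact h (idxPoint q) p

theorem summable_mul_of_rapidDecay {c : Idx2 d → ℂ}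
    (hc : ∀ N : ℕ, ∃ C, ∀ q, (1 + ‖idxPoint q‖) ^ N * ‖c q‖ ≤ C) {a : Idx2 d → ℝ} {C : ℝ} {N : ℕ}
    (h0 : ∀ q, 0 ≤ a q) (ha : ∀ q, a q ≤ C * (1 + ‖idxPoint q‖) ^ N) :
    Summable fun q => ‖c q‖ * a q := by
  obtain ⟨M, hM⟩ := exists_summable_one_add_norm_idxPoint d
  obtain ⟨C', hC'⟩ := hc (N + M)
  refine Summable.of_nonneg_of_le (fun q => mul_nonneg (norm_nonneg _) (h0 q)) (fun q => ?_)
    (hM.mul_left (|C| * C'))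
  have hpos : 0 < (1 + ‖idxPoint q‖) ^ M := by positivity
  rw [← div_eq_mul_inv, le_div_iff₀ hpos]
  calc ‖c q‖ * a q * (1 + ‖idxPoint q‖) ^ M
      ≤ ‖c q‖ * (|C| * (1 + ‖idxPoint q‖) ^ N) * (1 + ‖idxPoint q‖) ^ M := by
        gcongr
        exact (ha q).trans (by gcongr; exact le_abs_self C)
    _ = |C| * ((1 + ‖idxPoint q‖) ^ (N + M) * ‖c q‖) := by rw [pow_add]; ring
    _ ≤ |C| * C' := by gcongr; exact hC' q

theorem hasSum_gabor_expansion (hB : IsRegularMagneticField d B) (hg : IsWindow d g)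
    {T : Idx2 d → SchwartzMap (E2 d) ℂ} (hT : ∀ q, ⇑(T q) = gaborDual d B g q.1 q.2)
    (H : SchwartzMap (E2 d) ℂ) :
    HasSum (fun q : Idx2 d => (∫ p : E2 d, gaborTensor d B g q.1 q.2 p * H p) • T q) H := by
  obtain ⟨K, hK⟩ := exists_schwartzMap_conj_dualWindow_mul hB hg H
  simp only [integral_gaborTensor_mul hK]
  have hc : ∀ N : ℕ, ∃ C, ∀ q : Idx2 d, (1 + ‖idxPoint q‖) ^ N *
      ‖oscIntegral volume (dotL2 d) K (idxPoint q).1 (idxPoint q).2‖ ≤ C := by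
    intro N
    obtain ⟨C, hC⟩ := exists_norm_oscIntegral_le volume (dotL2 d) _ norm_le_sum_abs_dotL2 K N
    exact ⟨C, fun q => hC (idxPoint q)⟩
  have hsemi : ∀ k n : ℕ, Summable fun q : Idx2 d => SchwartzMap.seminorm ℝ k n
      (oscIntegral volume (dotL2 d) K (idxPoint q).1 (idxPoint q).2 • T q) := by
    intro k n
    obtain ⟨C, N, -, h⟩ := exists_seminorm_le_of_eq_gaborDual hB hg hT k n
    refine (summable_mul_of_rapidDecay hc (fun q => apply_nonneg _ _) h).congr fun q => ?_
    exact (map_smul_eq_mul (SchwartzMap.seminorm ℂ k n) _ (T q)).symm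
  have hs : Summable fun q : Idx2 d =>
      oscIntegral volume (dotL2 d) K (idxPoint q).1 (idxPoint q).2 := by
    refine .of_norm ?_
    simpa using summable_mul_of_rapidDecay hc (a := fun _ => 1) (C := 1) (N := 0)
      (fun _ => zero_le_one) (fun _ => by simp)
  refine SchwartzMap.hasSum_of_summable_seminorm hsemi fun p => ?_
  have hTp : ∀ q, T q p =
      modulated (dotL2 d) (dualWindow d B g) p (idxPoint q).1 (idxPoint q).2 := fun q => by
    rw [hT, gaborDual_eq_modulated]
  have hpt : Summable fun q : Idx2 d =>
      (oscIntegral volume (dotL2 d) K (idxPoint q).1 (idxPoint q).2 • T q) p :=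
    .of_norm_bounded (hsemi 0 0) fun q => SchwartzMap.norm_le_seminorm ℝ _ p
  simp only [smul_apply, smul_eq_mul, hTp] at hpt ⊢
  exact hasSum_oscIntegral_mul_modulated hg hK hs hpt

end GaborExpansion

/-- the frame expansion of a tempered distribution converges to it in the
weak-* sense, with absolute convergence of the series. -/
theorem statement13 (d : ℕ) (hd : 0 < d) (B : Fin d → Fin d → (Fin d → ℝ) → ℝ)
    (hB : IsRegularMagneticField d B) (g : (Fin d → ℝ) → ℝ) (hg : IsWindow d g)
    (u : SchwartzMap (E2 d) ℂ →L[ℂ] ℂ)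
    (T : Idx2 d → SchwartzMap (E2 d) ℂ)
    (hT : ∀ q : Idx2 d, ⇑(T q) = gaborDual d B g q.1 q.2)
    (H : SchwartzMap (E2 d) ℂ) :
    Summable (fun q : Idx2 d =>
        ‖u (T q) * ∫ p : E2 d, gaborTensor d B g q.1 q.2 p * H p‖) ∧
    ∑' q : Idx2 d, u (T q) * ∫ p : E2 d, gaborTensor d B g q.1 q.2 p * H p = u H := by
  have h := u.hasSum (hasSum_gabor_expansion hB hg hT H)
  simp only [map_smul, smul_eq_mul, mul_comm _ (u (T _))] at h
  exact ⟨h.summable.norm, h.tsum_eq⟩
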